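/- arXiv:1908.04559 — 12 statements merged into one kernel-verified Lean document; each statement's English description precedes it below -/
import Mathlib

section
/- Let S be a monoid and let B and C be proper subacts of a right S-act A. Then B ∪ C is a superfluous subact of A if and only if both B and C are superfluous subacts of A. -/
variable {S : Type*} [Monoid S] {A : Type*}

/-- A subact of a right `S`-act: a nonempty subset closed under the action. -/
def IsSubact (act : A → S → A) (B : Set A) : Prop :=
  B.Nonempty ∧ ∀ b ∈ B, ∀ s : S, act b s ∈ B

/-- `C` is superfluous in the whole act `A`: its union with any proper subact is proper. -/
def Superfluous (act : A → S → A) (C : Set A) : Prop :=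
  ∀ D : Set A, IsSubact act D → D ≠ Set.univ → C ∪ D ≠ Set.univ

/-- `C` is superfluous in the subact `B` (viewed as a right `S`-act in its own right). -/
def SuperfluousIn (act : A → S → A) (C B : Set A) : Prop :=
  ∀ D : Set A, IsSubact act D → D ⊆ B → D ≠ B → C ∪ D ≠ B

/-- `C` is coessential in `A`: for every proper subact `D` meeting `C`, `C ∪ D ≠ A`. -/
def Coessential (act : A → S → A) (C : Set A) : Prop :=
  ∀ D : Set A, IsSubact act D → D ≠ Set.univ → (C ∩ D).Nonempty → C ∪ D ≠ Set.univ

/-- The act `A` is indecomposable: not a union of two disjoint subacts. -/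
def IndecomposableAct (act : A → S → A) : Prop :=
  ¬ ∃ B C : Set A, IsSubact act B ∧ IsSubact act C ∧ B ∩ C = ∅ ∧ B ∪ C = Set.univ

/-- The subact `B` is indecomposable as an act in its own right. -/
def IndecompIn (act : A → S → A) (B : Set A) : Prop :=
  ¬ ∃ C D : Set A, IsSubact act C ∧ IsSubact act D ∧ C ⊆ B ∧ D ⊆ B ∧
      C ∩ D = ∅ ∧ C ∪ D = B

/-- The act `A` is simple: it has no proper subacts. -/
def SimpleAct (act : A → S → A) : Prop :=
  ∀ B : Set A, IsSubact act B → B = Set.univ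

/-- The subact `B` is simple as an act in its own right. -/
def SimpleIn (act : A → S → A) (B : Set A) : Prop :=
  ∀ C : Set A, IsSubact act C → C ⊆ B → C = B

/-- The act `A` is hollow: every proper subact is superfluous. -/
def Hollow (act : A → S → A) : Prop :=
  ∀ B : Set A, IsSubact act B → B ≠ Set.univ → Superfluous act B

/-- The subact `B` is hollow as an act in its own right. -/
def HollowIn (act : A → S → A) (B : Set A) : Prop :=
  ∀ C : Set A, IsSubact act C → C ⊆ B → C ≠ B → SuperfluousIn act C B

/-- The act `A` is co-uniform: every proper subact is coessential. -/
def CoUniform (act : A → S → A) : Prop :=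
  ∀ B : Set A, IsSubact act B → B ≠ Set.univ → Coessential act B

/-- The act `A` is cyclic: `A = aS` for some `a`. -/
def Cyclic (act : A → S → A) : Prop :=
  ∃ a : A, Set.range (act a) = Set.univ

/-- The act `A` is locally cyclic. -/
def LocallyCyclic (act : A → S → A) : Prop :=
  ∀ a a' : A, ∃ a'' : A, a ∈ Set.range (act a'') ∧ a' ∈ Set.range (act a'')

/-- The set `G` generates the act `A`. -/
def Generates (act : A → S → A) (G : Set A) : Prop :=
  (⋃ g ∈ G, Set.range (act g)) = Set.univ

/-- The act `A` is finitely generated. -/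
def FinGen (act : A → S → A) : Prop :=
  ∃ F : Finset A, (⋃ a ∈ F, Set.range (act a)) = Set.univ

/-- `M` is a maximal subact of `A`: a proper subact such that the only subact
strictly containing it is `A` itself. -/
def IsMaxSubact (act : A → S → A) (M : Set A) : Prop :=
  IsSubact act M ∧ M ≠ Set.univ ∧ ∀ C : Set A, IsSubact act C → M ⊂ C → C = Set.univ

/-- The act `A` is local: it has exactly one maximal subact. -/
def LocalAct (act : A → S → A) : Prop :=
  ∃! M : Set A, IsMaxSubact act M

/-- The radical of `A`: the intersection of all maximal subacts
(`= A` when there is no maximal subact, since `⋂₀ ∅ = Set.univ`). -/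
def RadAct (act : A → S → A) : Set A :=
  ⋂₀ {M : Set A | IsMaxSubact act M}

/-- `C` is a supplement of `B` in `A`. -/
def IsSupplement (act : A → S → A) (B C : Set A) : Prop :=
  IsSubact act C ∧ B ∪ C = Set.univ ∧
    ∀ D : Set A, IsSubact act D → D ⊆ C → B ∪ D = Set.univ → D = C

/-- The act `A` is supplemented: every proper subact has a supplement. -/
def Supplemented (act : A → S → A) : Prop :=
  ∀ B : Set A, IsSubact act B → B ≠ Set.univ → ∃ C : Set A, IsSupplement act B C

theorem IsSubact.union {act : A → S → A} {B C : Set A}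
    (hB : IsSubact act B) (hC : IsSubact act C) : IsSubact act (B ∪ C) :=
  ⟨hB.1.inl, fun b hb s => hb.imp (fun h => hB.2 b h s) (fun h => hC.2 b h s)⟩

/-- A subset of a superfluous set is superfluous. -/
theorem Superfluous.anti {act : A → S → A} {B C : Set A}
    (hC : Superfluous act C) (hBC : B ⊆ C) : Superfluous act B :=
  fun D hD hDp h =>
    hC D hD hDp (Set.univ_subset_iff.mp (h ▸ Set.union_subset_union_left D hBC))

/-- for proper subacts `B`, `C` of `A`, `B ∪ C` is superfluous
iff both `B` and `C` are superfluous. -/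
theorem union_superfluous_iff
    (act : A → S → A) [Nonempty A]
    (hone : ∀ a : A, act a 1 = a)
    (hmul : ∀ (a : A) (s t : S), act a (s * t) = act (act a s) t)
    (B C : Set A) (hB : IsSubact act B) (hC : IsSubact act C)
    (hBp : B ≠ Set.univ) (hCp : C ≠ Set.univ) :
    Superfluous act (B ∪ C) ↔ Superfluous act B ∧ Superfluous act C := by
  constructor
  · intro h
    exact ⟨h.anti Set.subset_union_left, h.anti Set.subset_union_right⟩
  · rintro ⟨hB', hC'⟩ D hD hDp
    rw [Set.union_assoc]
    exact hB' _ (hC.union hD) (hC' D hD hDp)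
end

section
/- Let S be a monoid, A a hollow right S-act, and f : A → C a surjective S-homomorphism onto a right S-act C. Then C is hollow. -/
variable {S : Type*} [Monoid S] {A : Type*}

theorem IsSubact.preimage {T X Y : Type*} {actX : X → T → X} {actY : Y → T → Y} {f : X → Y}
    (hf : ∀ (x : X) (t : T), f (actX x t) = actY (f x) t) (hsurj : Function.Surjective f)
    {B : Set Y} (hB : IsSubact actY B) : IsSubact actX (f ⁻¹' B) :=
  ⟨hB.1.preimage hsurj, fun x hx t => by
    rw [Set.mem_preimage, hf]
    exact hB.2 _ hx t⟩

/-- every surjective homomorphic image of a hollow act is hollow. -/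
theorem hollow_of_surjective {C : Type*}
    (actA : A → S → A) (actC : C → S → C) [Nonempty A] [Nonempty C]
    (honeA : ∀ a : A, actA a 1 = a)
    (hmulA : ∀ (a : A) (s t : S), actA a (s * t) = actA (actA a s) t)
    (honeC : ∀ c : C, actC c 1 = c)
    (hmulC : ∀ (c : C) (s t : S), actC c (s * t) = actC (actC c s) t)
    (hH : Hollow actA)
    (f : A → C) (hf : ∀ (a : A) (s : S), f (actA a s) = actC (f a) s)
    (hsurj : Function.Surjective f) :
    Hollow actC := by
  have preimage_ne {B : Set C} (hB : B ≠ Set.univ) : f ⁻¹' B ≠ Set.univ :=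
    fun h => hB (hsurj.preimage_injective (h.trans Set.preimage_univ.symm))
  intro B hB hBne D hD hDne hBD
  refine hH _ (hB.preimage hf hsurj) (preimage_ne hBne) _ (hD.preimage hf hsurj)
    (preimage_ne hDne) ?_
  rw [← Set.preimage_union, hBD, Set.preimage_univ]
end

section
/- Let S be a monoid. Every locally cyclic right S-act is hollow; in particular, every cyclic right S-act is hollow. -/
variable {S : Type*} [Monoid S] {A : Type*}

/-- A locally cyclic act is hollow: a point outside `B` and a point outside `D` have a common
generator, which lies outside both. -/
theorem LocallyCyclic.hollow {act : A → S → A} (h : LocallyCyclic act) : Hollow act := by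
  intro B hB hBne D hD hDne hBD
  obtain ⟨b, hb⟩ := (Set.ne_univ_iff_exists_notMem B).1 hBne
  obtain ⟨d, hd⟩ := (Set.ne_univ_iff_exists_notMem D).1 hDne
  obtain ⟨c, ⟨s, rfl⟩, ⟨t, rfl⟩⟩ := h b d
  rcases (hBD ▸ Set.mem_univ c : c ∈ B ∪ D) with hc | hc
  · exact hb (hB.2 c hc s)
  · exact hd (hD.2 c hc t)

/-- A cyclic act is locally cyclic. -/
theorem Cyclic.locallyCyclic {act : A → S → A} (h : Cyclic act) : LocallyCyclic act := by
  obtain ⟨a, ha⟩ := h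
  exact fun b c => ⟨a, ha ▸ Set.mem_univ b, ha ▸ Set.mem_univ c⟩

/-- every locally cyclic right `S`-act is hollow; in particular,
every cyclic right `S`-act is hollow. -/
theorem locallyCyclic_hollow_and_cyclic_hollow
    (act : A → S → A) [Nonempty A]
    (hone : ∀ a : A, act a 1 = a)
    (hmul : ∀ (a : A) (s t : S), act a (s * t) = act (act a s) t) :
    (LocallyCyclic act → Hollow act) ∧ (Cyclic act → Hollow act) := by
  exact ⟨fun h => h.hollow, fun h => h.locallyCyclic.hollow⟩
end

section
/- Let S be a monoid. A right S-act A is hollow if and only if A is indecomposable and co-uniform. -/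
variable {S : Type*} [Monoid S] {A : Type*}

/-- `A` is hollow iff `A` is indecomposable and co-uniform. -/
theorem hollow_iff_indecomposable_coUniform
    (act : A → S → A) [Nonempty A]
    (hone : ∀ a : A, act a 1 = a)
    (hmul : ∀ (a : A) (s t : S), act a (s * t) = act (act a s) t) :
    Hollow act ↔ IndecomposableAct act ∧ CoUniform act := by
  constructor
  · refine fun h ↦ ⟨?_, fun B hB hB' D hD hD' _ ↦ h B hB hB' D hD hD'⟩
    rintro ⟨B, C, hB, hC, hdisj, hunion⟩
    refine h B hB ?_ C hC ?_ hunion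
    · rintro rfl
      exact hC.1.ne_empty (by simpa using hdisj)
    · rintro rfl
      exact hB.1.ne_empty (by simpa using hdisj)
  · rintro ⟨hind, hco⟩ B hB hB' D hD hD' hunion
    obtain hdisj | hmeet := (B ∩ D).eq_empty_or_nonempty
    · exact hind ⟨B, D, hB, hD, hdisj, hunion⟩
    · exact hco B hB hB' D hD hD' hmeet hunion
end

section
/- Let S be a monoid and A a right S-act. The following are equivalent: (i) A is uniserial; (ii) every subact of A is hollow; (iii) every subact of A generated by two elements (i.e., of the form xS ∪ yS with x, y ∈ A) is hollow. -/
variable {S : Type*} [Monoid S] {A : Type*}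

theorem isSubact_range (act : A → S → A)
    (hmul : ∀ (a : A) (s t : S), act a (s * t) = act (act a s) t) (x : A) :
    IsSubact act (Set.range (act x)) := by
  refine ⟨⟨act x 1, 1, rfl⟩, ?_⟩
  rintro _ ⟨s, rfl⟩ t
  exact ⟨s * t, hmul x s t⟩

theorem IsSubact.range_subset {act : A → S → A} {B : Set A} (hB : IsSubact act B) {x : A}
    (hx : x ∈ B) : Set.range (act x) ⊆ B :=
  Set.range_subset_iff.2 (hB.2 x hx)

/-- `A` is uniserial iff every subact of `A` is hollow iff every subact
of `A` generated by two elements is hollow. -/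
theorem uniserial_tfae
    (act : A → S → A) [Nonempty A]
    (hone : ∀ a : A, act a 1 = a)
    (hmul : ∀ (a : A) (s t : S), act a (s * t) = act (act a s) t) :
    List.TFAE
      [∀ B C : Set A, IsSubact act B → IsSubact act C → B ⊆ C ∨ C ⊆ B,
       ∀ B : Set A, IsSubact act B → HollowIn act B,
       ∀ x y : A, HollowIn act (Set.range (act x) ∪ Set.range (act y))] := by
  tfae_have 1 → 2 := by
    intro h B _ C hC _ hCne D hD _ hDne hU
    rcases h C D hC hD with hCD | hDC
    · exact hDne (by rwa [Set.union_eq_self_of_subset_left hCD] at hU)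
    · exact hCne (by rwa [Set.union_eq_self_of_subset_right hDC] at hU)
  tfae_have 2 → 3 := fun h x y =>
    h _ ((isSubact_range act hmul x).union (isSubact_range act hmul y))
  tfae_have 3 → 1 := by
    intro h B C hB hC
    by_contra! hBC
    obtain ⟨x, hxB, hxC⟩ := Set.not_subset.1 hBC.1
    obtain ⟨y, hyC, hyB⟩ := Set.not_subset.1 hBC.2
    refine h x y _ (isSubact_range act hmul x) Set.subset_union_left (fun hE => ?_)
      _ (isSubact_range act hmul y) Set.subset_union_right (fun hE => ?_) rfl
    · exact hyB (hB.range_subset hxB (hE.symm ▸ Or.inr ⟨1, hone y⟩))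
    · exact hxC (hC.range_subset hyC (hE.symm ▸ Or.inl ⟨1, hone x⟩))
  tfae_finish
end

section
/- Let S be a monoid. Every hollow right S-act possessing a minimal generating set is cyclic; consequently, every finitely generated hollow right S-act is cyclic. -/
variable {S : Type*} [Monoid S] {A : Type*}

theorem isSubact_iUnion_range (act : A → S → A)
    (hmul : ∀ (a : A) (s t : S), act a (s * t) = act (act a s) t)
    {G : Set A} (hG : G.Nonempty) : IsSubact act (⋃ g ∈ G, Set.range (act g)) := by
  obtain ⟨g, hg⟩ := hG
  refine ⟨⟨act g 1, Set.mem_biUnion hg ⟨1, rfl⟩⟩, fun b hb s => ?_⟩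
  obtain ⟨x, hx, t, rfl⟩ := Set.mem_iUnion₂.1 hb
  exact Set.mem_biUnion hx ⟨t * s, hmul x t s⟩

theorem Generates.nonempty {S A : Type*} [Nonempty A] {act : A → S → A} {G : Set A}
    (hG : Generates act G) : G.Nonempty := by
  by_contra h
  rw [Set.not_nonempty_iff_eq_empty] at h
  simp [Generates, h, Set.empty_ne_univ] at hG

theorem Hollow.cyclic_of_minimal_generates [Nonempty A] {act : A → S → A}
    (hmul : ∀ (a : A) (s t : S), act a (s * t) = act (act a s) t)
    (hA : Hollow act) {G : Set A} (hG : Generates act G)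
    (hmin : ∀ G' : Set A, G' ⊂ G → ¬ Generates act G') : Cyclic act := by
  obtain ⟨g, hg⟩ := hG.nonempty
  have hcover : Set.range (act g) ∪ (⋃ x ∈ G \ {g}, Set.range (act x)) = Set.univ := by
    rw [← Set.biUnion_insert g _ fun x => Set.range (act x), Set.insert_sdiff_singleton,
      Set.insert_eq_of_mem hg]
    exact hG
  rcases (G \ {g}).eq_empty_or_nonempty with hempty | hne
  · exact ⟨g, by simpa [hempty] using hcover⟩
  · by_contra hcyc
    have hsub : IsSubact act (Set.range (act g)) := by
      simpa using isSubact_iUnion_range act hmul (Set.singleton_nonempty g)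
    exact hA _ hsub (fun h => hcyc ⟨g, h⟩) _ (isSubact_iUnion_range act hmul hne)
      (hmin _ (Set.sdiff_singleton_ssubset.2 hg)) hcover

theorem FinGen.exists_minimal_generates {S A : Type*} {act : A → S → A} (h : FinGen act) :
    ∃ G : Set A, Generates act G ∧ ∀ G' : Set A, G' ⊂ G → ¬ Generates act G' := by
  obtain ⟨F, hF⟩ := h
  obtain ⟨M, hM, hmin⟩ := exists_minimal_of_wellFoundedLT
    (fun F : Finset A => Generates act (F : Set A)) ⟨F, by simpa [Generates] using hF⟩
  refine ⟨M, hM, fun G' hG' hgen => ?_⟩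
  lift G' to Finset A using M.finite_toSet.subset hG'.subset
  exact hG'.2 (Finset.coe_subset.2 (hmin hgen (Finset.coe_subset.1 hG'.1)))

/-- every hollow act possessing a minimal generating set is cyclic;
consequently, every finitely generated hollow act is cyclic. -/
theorem hollow_minimal_generating_cyclic
    (act : A → S → A) [Nonempty A]
    (hone : ∀ a : A, act a 1 = a)
    (hmul : ∀ (a : A) (s t : S), act a (s * t) = act (act a s) t) :
    (Hollow act →
      (∃ G : Set A, Generates act G ∧ ∀ G' : Set A, G' ⊂ G → ¬ Generates act G') →
      Cyclic act) ∧
    (Hollow act → FinGen act → Cyclic act) := by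
  exact ⟨fun hA ⟨_, hG, hmin⟩ => hA.cyclic_of_minimal_generates hmul hG hmin, fun hA hfin =>
    let ⟨_, hG, hmin⟩ := hfin.exists_minimal_generates
    hA.cyclic_of_minimal_generates hmul hG hmin⟩
end

section
/- Let S be a monoid, A a hollow right S-act, and f : D → A a coessential epimorphism of right S-acts (i.e., f is surjective and its restriction to every proper subact of D is not surjective). Then D is indecomposable. -/
variable {S : Type*} [Monoid S] {A : Type*}

/-- The image of a subact under an `S`-homomorphism is a subact. -/
theorem IsSubact.image {D : Type*} {actD : D → S → D} {actA : A → S → A} {f : D → A}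
    (hf : ∀ (d : D) (s : S), f (actD d s) = actA (f d) s) {B : Set D} (hB : IsSubact actD B) :
    IsSubact actA (f '' B) := by
  refine ⟨hB.1.image f, ?_⟩
  rintro _ ⟨b, hb, rfl⟩ s
  exact ⟨actD b s, hB.2 b hb s, hf b s⟩

/-- every cover (coessential epimorphic preimage) of a hollow act is
indecomposable. -/
theorem cover_of_hollow_indecomposable {D : Type*}
    (actD : D → S → D) (actA : A → S → A) [Nonempty D] [Nonempty A]
    (honeD : ∀ d : D, actD d 1 = d)
    (hmulD : ∀ (d : D) (s t : S), actD d (s * t) = actD (actD d s) t)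
    (honeA : ∀ a : A, actA a 1 = a)
    (hmulA : ∀ (a : A) (s t : S), actA a (s * t) = actA (actA a s) t)
    (hH : Hollow actA)
    (f : D → A) (hf : ∀ (d : D) (s : S), f (actD d s) = actA (f d) s)
    (hsurj : Function.Surjective f)
    (hcoess : ∀ C : Set D, IsSubact actD C → C ≠ Set.univ → f '' C ≠ Set.univ) :
    IndecomposableAct actD := by
  rintro ⟨B, C, hB, hC, hdisj, hunion⟩
  have hB_ne : B ≠ Set.univ := by
    rintro rfl
    exact hC.1.ne_empty (by simpa using hdisj)
  have hC_ne : C ≠ Set.univ := by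
    rintro rfl
    exact hB.1.ne_empty (by simpa using hdisj)
  refine hH (f '' B) (hB.image hf) (hcoess B hB hB_ne) (f '' C) (hC.image hf)
    (hcoess C hC hC_ne) ?_
  rw [← Set.image_union, hunion, Set.image_univ, hsurj.range_eq]
end

section
/- Let S be a monoid. Every cyclic right S-act is simple or local. -/
variable {S : Type*} [Monoid S] {A : Type*}

/-- every cyclic right `S`-act is simple or local. -/
theorem cyclic_simple_or_local
    (act : A → S → A) [Nonempty A]
    (hone : ∀ a : A, act a 1 = a)
    (hmul : ∀ (a : A) (s t : S), act a (s * t) = act (act a s) t)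
    (hcyc : Cyclic act) :
    SimpleAct act ∨ LocalAct act := by
  obtain ⟨a, ha⟩ := hcyc
  have univ_of_mem : ∀ B : Set A, IsSubact act B → a ∈ B → B = Set.univ := by
    intro B hB haB
    refine Set.univ_subset_iff.mp (ha ▸ ?_)
    rintro _ ⟨s, rfl⟩
    exact hB.2 a haB s
  refine or_iff_not_imp_left.mpr fun hsimple => ?_
  -- The unique maximal subact is the union of all subacts avoiding the generator.
  set M : Set A := {x | ∃ B, IsSubact act B ∧ a ∉ B ∧ x ∈ B} with hM
  have haM : a ∉ M := fun ⟨_, _, haB, haB'⟩ => haB haB'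
  have hMne : M ≠ Set.univ := fun h => haM (h ▸ Set.mem_univ a)
  have subset_M : ∀ B : Set A, IsSubact act B → B ≠ Set.univ → B ⊆ M :=
    fun B hB hne x hx => ⟨B, hB, fun haB => hne (univ_of_mem B hB haB), hx⟩
  have hMsub : IsSubact act M := by
    constructor
    · obtain ⟨B, hB⟩ := not_forall.mp hsimple
      obtain ⟨hB, hne⟩ := Classical.not_imp.mp hB
      exact hB.1.mono (subset_M B hB hne)
    · rintro x ⟨B, hB, haB, hx⟩ s
      exact ⟨B, hB, haB, hB.2 x hx s⟩
  refine ⟨M, ⟨hMsub, hMne, fun C hC hMC => ?_⟩, fun N hN => ?_⟩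
  · by_contra hne
    exact hMC.2 (subset_M C hC hne)
  · by_contra hne
    exact hMne (hN.2.2 M hMsub ((subset_M N hN.1 hN.2.1).ssubset_of_ne hne))
end

section
/- Let S be a monoid and A a right S-act. Then Rad(A) = ⋃{B : B is a superfluous subact of A}, i.e., the radical of A equals the union of all superfluous subacts of A (as subsets of A). -/
variable {S : Type*} [Monoid S] {A : Type*}

/-- A superfluous subact lies in every maximal subact. -/
theorem Superfluous.subset_of_isMaxSubact {act : A → S → A} {B M : Set A}
    (hsup : Superfluous act B) (hB : IsSubact act B) (hM : IsMaxSubact act M) : B ⊆ M := by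
  by_contra h
  exact hsup M hM.1 hM.2.1 (hM.2.2 _ (hB.union hM.1)
    ⟨Set.subset_union_right, fun h' => h (Set.subset_union_left.trans h')⟩)

/-- If `xS` together with a proper subact covers `A`, then the elements not generating `x`
form a maximal subact. -/
theorem isMaxSubact_setOf_notMem_range {act : A → S → A}
    (hone : ∀ a : A, act a 1 = a)
    (hmul : ∀ (a : A) (s t : S), act a (s * t) = act (act a s) t)
    {x : A} {D : Set A} (hD : IsSubact act D) (hne : D ≠ Set.univ)
    (hun : Set.range (act x) ∪ D = Set.univ) :
    IsMaxSubact act {a | x ∉ Set.range (act a)} := by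
  have range_subset {C : Set A} (hC : IsSubact act C) (hx : x ∈ C) : Set.range (act x) ⊆ C :=
    Set.range_subset_iff.2 (hC.2 x hx)
  have hxD : x ∉ D := fun hx => hne (by
    rwa [Set.union_eq_self_of_subset_left (range_subset hD hx)] at hun)
  have hDM : D ⊆ {a | x ∉ Set.range (act a)} := by
    rintro d hd ⟨s, rfl⟩
    exact hxD (hD.2 d hd s)
  refine ⟨⟨hD.1.mono hDM, ?_⟩, ?_, ?_⟩
  · rintro b hb s ⟨t, ht⟩
    exact hb ⟨s * t, (hmul b s t).trans ht⟩
  · intro h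
    exact (Set.eq_univ_iff_forall.1 h x) ⟨1, hone x⟩
  · intro C hC hMC
    obtain ⟨c, hc, hcM⟩ := Set.exists_of_ssubset hMC
    obtain ⟨s, hs⟩ := not_not.1 hcM
    have hxC : x ∈ C := hs ▸ hC.2 c hc s
    exact Set.univ_subset_iff.1
      (hun ▸ Set.union_subset (range_subset hC hxC) (hDM.trans hMC.subset))

/-- the radical of `A` is the union of all superfluous subacts of `A`. -/
theorem rad_eq_sUnion_superfluous
    (act : A → S → A) [Nonempty A]
    (hone : ∀ a : A, act a 1 = a)
    (hmul : ∀ (a : A) (s t : S), act a (s * t) = act (act a s) t) :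
    RadAct act = ⋃₀ {B : Set A | IsSubact act B ∧ Superfluous act B} := by
  ext x
  constructor
  · intro hx
    refine ⟨Set.range (act x), ⟨isSubact_range act hmul x, fun D hD hne hun => ?_⟩, 1, hone x⟩
    exact hx _ (isMaxSubact_setOf_notMem_range hone hmul hD hne hun) ⟨1, hone x⟩
  · rintro ⟨B, ⟨hB, hsup⟩, hxB⟩ M hM
    exact hsup.subset_of_isMaxSubact hB hM hxB
end

section
/- Let S be a monoid, A a right S-act, and B a subact of A which, as a right S-act, is hollow and not cyclic. Then B ⊆ Rad(A). -/
variable {S : Type*} [Monoid S] {A : Type*}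

/-- every non-cyclic hollow subact of `A` is contained in `Rad(A)`. -/
theorem hollow_noncyclic_subset_rad
    (act : A → S → A) [Nonempty A]
    (hone : ∀ a : A, act a 1 = a)
    (hmul : ∀ (a : A) (s t : S), act a (s * t) = act (act a s) t)
    (B : Set A) (hB : IsSubact act B)
    (hH : HollowIn act B)
    (hnc : ¬ ∃ b ∈ B, Set.range (act b) = B) :
    B ⊆ RadAct act := by
  intro b hb M hM
  obtain ⟨hMsub, -, hMmax⟩ := hM
  by_contra hbM
  have hbmem : b ∈ Set.range (act b) := ⟨1, hone b⟩
  have hbS : IsSubact act (Set.range (act b)) := by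
    refine ⟨⟨b, hbmem⟩, ?_⟩
    rintro _ ⟨s, rfl⟩ t
    exact ⟨s * t, hmul b s t⟩
  have hbB : Set.range (act b) ⊆ B := by
    rintro _ ⟨s, rfl⟩
    exact hB.2 b hb s
  have hbne : Set.range (act b) ≠ B := fun h => hnc ⟨b, hb, h⟩
  have hsup : M ∪ Set.range (act b) = Set.univ := by
    refine hMmax _ ⟨hMsub.1.mono Set.subset_union_left, ?_⟩
      ⟨Set.subset_union_left, fun h => hbM (h (Or.inr hbmem))⟩
    rintro x (hx | hx) s
    · exact Or.inl (hMsub.2 x hx s)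
    · exact Or.inr (hbS.2 x hx s)
  have hcover : Set.range (act b) ∪ M ∩ B = B := by
    rw [Set.union_inter_distrib_left, Set.union_comm _ M, hsup, Set.univ_inter,
      Set.union_eq_right.mpr hbB]
  rcases (M ∩ B).eq_empty_or_nonempty with hemp | hne
  · exact hbne (by rwa [hemp, Set.union_empty] at hcover)
  · exact hH _ hbS hbB hbne (M ∩ B)
      ⟨hne, fun x hx s => ⟨hMsub.2 x hx.1 s, hB.2 x hx.2 s⟩⟩ Set.inter_subset_right
      (fun h => hbM (h.symm.subset hb).1) hcover
end

section
/- Let S be a monoid and A a right S-act. Then Rad(A) ∪ C ≠ A for every proper subact C of A (i.e., the radical is superfluous in A, as a subset) if and only if every proper subact of A is contained in a maximal subact of A. -/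
variable {S : Type*} [Monoid S] {A : Type*}

/-- `Rad(A)` is superfluous in `A` iff every proper subact of `A` is
contained in a maximal subact. -/
theorem rad_superfluous_iff
    (act : A → S → A) [Nonempty A]
    (hone : ∀ a : A, act a 1 = a)
    (hmul : ∀ (a : A) (s t : S), act a (s * t) = act (act a s) t) :
    Superfluous act (RadAct act) ↔
      ∀ B : Set A, IsSubact act B → B ≠ Set.univ →
        ∃ M : Set A, IsMaxSubact act M ∧ B ⊆ M := by
  constructor
  · intro h B hB hBne
    obtain ⟨a, ha⟩ := (Set.ne_univ_iff_exists_notMem _).1 (h B hB hBne)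
    have haR : a ∉ RadAct act := fun h' => ha (Or.inl h')
    have haB : a ∉ B := fun h' => ha (Or.inr h')
    simp only [RadAct, Set.mem_sInter, Set.mem_ofPred_eq, not_forall] at haR
    obtain ⟨M, hM, haM⟩ := haR
    refine ⟨M, hM, ?_⟩
    by_contra hBM
    have hss : M ⊂ B ∪ M :=
      ⟨Set.subset_union_right, fun h' => hBM (Set.subset_union_left.trans h')⟩
    have hu := hM.2.2 _ (hB.union hM.1) hss
    have hau : a ∈ B ∪ M := hu ▸ Set.mem_univ a
    exact hau.elim haB haM
  · intro h D hD hDne hu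
    obtain ⟨M, hM, hDM⟩ := h D hD hDne
    exact hM.2.1 (Set.univ_subset_iff.1
      (hu ▸ Set.union_subset (Set.sInter_subset_of_mem hM) hDM))
end

section
/- Let S be a monoid. Every co-uniform right S-act is supplemented. -/
variable {S : Type*} [Monoid S] {A : Type*}

/-- every co-uniform right `S`-act is supplemented. -/
theorem coUniform_supplemented
    (act : A → S → A) [Nonempty A]
    (hone : ∀ a : A, act a 1 = a)
    (hmul : ∀ (a : A) (s t : S), act a (s * t) = act (act a s) t)
    (h : CoUniform act) :
    Supplemented act := by
  intro B hB hB'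
  by_cases hsup : Superfluous act B
  · refine ⟨Set.univ, ⟨Set.univ_nonempty, fun _ _ _ => trivial⟩, Set.union_univ B, ?_⟩
    intro D hD _ hBD
    by_contra hne
    exact hsup D hD hne hBD
  · unfold Superfluous at hsup
    push Not at hsup
    obtain ⟨C, hC, hC', hBC⟩ := hsup
    have hdisj : ¬ (B ∩ C).Nonempty := fun hne => h B hB hB' C hC hC' hne hBC
    refine ⟨C, hC, hBC, fun D _ hDC hBD => hDC.antisymm fun x hx => ?_⟩
    have hx' : x ∈ B ∪ D := hBD ▸ Set.mem_univ x
    exact hx'.resolve_left fun hxB => hdisj ⟨x, hxB, hx⟩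
end
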